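/- Assume d ≥ 3. Then the positivity domain on anti-de Sitter space coincides with the polar wedge domain: W_M⁺(h) = {g·(cosh(s)·e₀ + sinh(s)·e₂) : g ∈ G^h, s > 0}. -/

import Mathlib

noncomputable section

/-- `V = ℝ^{d+1}`. -/
abbrev Vd (d : ℕ) : Type := Fin (d + 1) → ℝ

/-- The symmetric bilinear form `β(x,y) = x₀y₀ + x₁y₁ − x₂y₂ − ⋯ − x_dy_d`. -/
def betaB (d : ℕ) (x y : Vd d) : ℝ :=
  ∑ j : Fin (d + 1), (if (j : ℕ) ≤ 1 then (1 : ℝ) else -1) * x j * y j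

abbrev Mat (d : ℕ) : Type := Matrix (Fin (d + 1)) (Fin (d + 1)) ℝ

/-- The group `O(β)` of linear automorphisms of `V` preserving `β`,
as a set of matrices (with the subspace topology of `End(V)`). -/
def Obeta (d : ℕ) : Set (Mat d) :=
  {g | IsUnit g ∧ ∀ x y : Vd d, betaB d (g.mulVec x) (g.mulVec y) = betaB d x y}

/-- `G = SO_{2,d-1}(ℝ)_e`, the identity component of `O(β)`. -/
def Gset (d : ℕ) : Set (Mat d) := connectedComponentIn (Obeta d) 1

/-- Anti-de Sitter space `AdS^d = {x : β(x,x) = 1}`. -/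
def AdS (d : ℕ) : Set (Vd d) := {x | betaB d x x = 1}

/-- Standard basis vector `e_i`. -/
def evec (d : ℕ) (i : Fin (d + 1)) : Vd d := fun j => if j = i then 1 else 0

/-- The positive causal cone `V₊(e₀)` at the base point. -/
def Vplus (d : ℕ) : Set (Vd d) :=
  {v | betaB d (evec d 0) v = 0 ∧ 0 < betaB d v v ∧ 0 < betaB d v (evec d 1)}

/-- A pair `(x,y)` with `x ∈ M`, `β(x,y) = 0` is positive if some `g ∈ G`
moves it into the positive cone at the base point. -/
def posPair (d : ℕ) (x y : Vd d) : Prop :=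
  ∃ g ∈ Gset d, g.mulVec x = evec d 0 ∧ g.mulVec y ∈ Vplus d

/-- Representing `z = x + iy ∈ V_ℂ` as the pair `(x,y)`: the set
`M_ℂ ∩ (V + i V_{>0})`. -/
def TubeSrc (d : ℕ) : Set (Vd d × Vd d) :=
  {p | betaB d p.1 p.1 - betaB d p.2 p.2 = 1 ∧ betaB d p.1 p.2 = 0 ∧ 0 < betaB d p.2 p.2}

/-- The positive tube domain `𝒯_M⁺`: those `z = x + iy` in `M_ℂ ∩ 𝒯_V` for which
`Γ(z) = β(x,x)^{-1/2}(x,y)` is a positive pair. -/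
def TubePlus (d : ℕ) : Set (Vd d × Vd d) :=
  {p | p ∈ TubeSrc d ∧
    posPair d ((Real.sqrt (betaB d p.1 p.1))⁻¹ • p.1) ((Real.sqrt (betaB d p.1 p.1))⁻¹ • p.2)}

/-- The involution `τ_h = diag(1,−1,−1,1,…,1)`. -/
def tauh (d : ℕ) : Mat d :=
  Matrix.diagonal fun j : Fin (d + 1) => if (j : ℕ) = 1 ∨ (j : ℕ) = 2 then (-1 : ℝ) else 1

/-- The Euler element `h` with `h e₁ = e₂`, `h e₂ = e₁`, `h e_j = 0` otherwise. -/
def hmat (d : ℕ) : Mat d :=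
  Matrix.of fun i j : Fin (d + 1) =>
    if ((i : ℕ) = 1 ∧ (j : ℕ) = 2) ∨ ((i : ℕ) = 2 ∧ (j : ℕ) = 1) then (1 : ℝ) else 0

/-- The centralizer `G^h = {g ∈ G : gh = hg}`. -/
def Gh (d : ℕ) : Set (Mat d) := {g ∈ Gset d | g * hmat d = hmat d * g}

/-- The positivity domain `W_M⁺(h) = {x ∈ M : (x, hx) is positive}`. -/
def WplusDom (d : ℕ) : Set (Vd d) := {x ∈ AdS d | posPair d x ((hmat d).mulVec x)}

/-- `α_{it}(x) = (x₀, cos t·x₁ + i sin t·x₂, cos t·x₂ + i sin t·x₁, x₃, …, x_d)`,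
written as a pair (real part, imaginary part). -/
def alphaIt (d : ℕ) (t : ℝ) (x : Vd d) : Vd d × Vd d :=
  (fun j => if (j : ℕ) = 1 ∨ (j : ℕ) = 2 then Real.cos t * x j else x j,
   fun j => if (j : ℕ) = 1 then Real.sin t * x 2
            else if (j : ℕ) = 2 then Real.sin t * x 1 else 0)

/-- The KMS wedge domain `W_M^{KMS}(h)`. -/
def KMSdom (d : ℕ) : Set (Vd d) :=
  {x ∈ AdS d | ∀ t : ℝ, 0 < t → t < Real.pi → alphaIt d t x ∈ TubePlus d}

lemma betaB_add_left (d : ℕ) (x y z : Vd d) : betaB d (x + y) z = betaB d x z + betaB d y z := by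
  simp only [betaB, ← Finset.sum_add_distrib, Pi.add_apply]
  exact Finset.sum_congr rfl fun j _ => by ring

lemma betaB_smul_left (d : ℕ) (c : ℝ) (x y : Vd d) : betaB d (c • x) y = c * betaB d x y := by
  simp only [betaB, Finset.mul_sum, Pi.smul_apply, smul_eq_mul]
  exact Finset.sum_congr rfl fun j _ => by ring

lemma betaB_comm (d : ℕ) (x y : Vd d) : betaB d x y = betaB d y x :=
  Finset.sum_congr rfl fun j _ => by ring

lemma betaB_sub_left (d : ℕ) (x y z : Vd d) : betaB d (x - y) z = betaB d x z - betaB d y z := by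
  rw [sub_eq_add_neg, ← neg_one_smul ℝ y, betaB_add_left, betaB_smul_left]
  ring

lemma betaB_add_right (d : ℕ) (x y z : Vd d) : betaB d z (x + y) = betaB d z x + betaB d z y := by
  simp only [betaB_comm d z, betaB_add_left]

lemma betaB_sub_right (d : ℕ) (x y z : Vd d) : betaB d z (x - y) = betaB d z x - betaB d z y := by
  simp only [betaB_comm d z, betaB_sub_left]

lemma betaB_smul_right (d : ℕ) (c : ℝ) (x y : Vd d) : betaB d x (c • y) = c * betaB d x y := by
  simp only [betaB_comm d x, betaB_smul_left]

lemma betaB_evec_left (d : ℕ) (i : Fin (d + 1)) (z : Vd d) :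
    betaB d (evec d i) z = (if (i : ℕ) ≤ 1 then (1 : ℝ) else -1) * z i := by
  rw [betaB, Finset.sum_eq_single i]
  · simp [evec]
  · intro j _ hj
    simp [evec, hj]
  · simp

lemma betaB_evec_right (d : ℕ) (i : Fin (d + 1)) (z : Vd d) :
    betaB d z (evec d i) = (if (i : ℕ) ≤ 1 then (1 : ℝ) else -1) * z i := by
  rw [betaB_comm, betaB_evec_left]

lemma eq_zero_or_one_of_val_le_one {d : ℕ} (hd : 1 ≤ d) {j : Fin (d + 1)} (hj : (j : ℕ) ≤ 1) :
    j = 0 ∨ j = 1 := by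
  obtain ⟨n, rfl⟩ := Nat.exists_eq_add_of_le' hd
  simp only [Fin.ext_iff, Fin.val_zero, Fin.val_one]
  lia

lemma betaB_self_nonpos {d : ℕ} (hd : 1 ≤ d) {z : Vd d} (h0 : z 0 = 0) (h1 : z 1 = 0) :
    betaB d z z ≤ 0 := by
  refine Finset.sum_nonpos fun j _ => ?_
  split_ifs with hj
  · rcases eq_zero_or_one_of_val_le_one hd hj with rfl | rfl <;> simp [*]
  · nlinarith [mul_self_nonneg (z j)]

lemma eq_zero_of_betaB_self_eq_zero {d : ℕ} (hd : 1 ≤ d) {z : Vd d} (h0 : z 0 = 0) (h1 : z 1 = 0)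
    (h : betaB d z z = 0) : z = 0 := by
  have key := (Finset.sum_eq_zero_iff_of_nonpos (fun j _ => ?_)).1 h
  · ext j
    by_cases hj : (j : ℕ) ≤ 1
    · rcases eq_zero_or_one_of_val_le_one hd hj with rfl | rfl <;> simp [*]
    · simpa [hj] using key j (Finset.mem_univ j)
  · split_ifs with hj
    · rcases eq_zero_or_one_of_val_le_one hd hj with rfl | rfl <;> simp [*]
    · nlinarith [mul_self_nonneg (z j)]

lemma mem_Obeta_of_isometry {d : ℕ} {g : Mat d}
    (h : ∀ x y : Vd d, betaB d (g.mulVec x) (g.mulVec y) = betaB d x y) : g ∈ Obeta d := by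
  refine ⟨?_, h⟩
  rw [← Matrix.mulVec_injective_iff_isUnit]
  intro x y hxy
  have hxy' : g.mulVec x = g.mulVec y := hxy
  ext i
  have := h (x - y) (evec d i)
  rw [Matrix.mulVec_sub, hxy', sub_self, betaB_evec_right, ← zero_smul ℝ (0 : Vd d),
    betaB_smul_left, zero_mul] at this
  split_ifs at this <;> simp only [Pi.sub_apply] at this <;> linarith

lemma one_mem_Obeta (d : ℕ) : (1 : Mat d) ∈ Obeta d :=
  mem_Obeta_of_isometry fun x y => by simp

lemma mul_mem_Obeta {d : ℕ} {a b : Mat d} (ha : a ∈ Obeta d) (hb : b ∈ Obeta d) :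
    a * b ∈ Obeta d :=
  mem_Obeta_of_isometry fun x y => by
    rw [← Matrix.mulVec_mulVec, ← Matrix.mulVec_mulVec, ha.2, hb.2]

lemma mul_inv_of_mem_Obeta {d : ℕ} {a : Mat d} (ha : a ∈ Obeta d) : a * a⁻¹ = 1 :=
  Matrix.mul_nonsing_inv a ((Matrix.isUnit_iff_isUnit_det a).1 ha.1)

lemma inv_mul_of_mem_Obeta {d : ℕ} {a : Mat d} (ha : a ∈ Obeta d) : a⁻¹ * a = 1 :=
  Matrix.nonsing_inv_mul a ((Matrix.isUnit_iff_isUnit_det a).1 ha.1)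

lemma inv_mem_Obeta {d : ℕ} {a : Mat d} (ha : a ∈ Obeta d) : a⁻¹ ∈ Obeta d :=
  mem_Obeta_of_isometry fun x y => by
    rw [← ha.2, Matrix.mulVec_mulVec, Matrix.mulVec_mulVec, mul_inv_of_mem_Obeta ha]
    simp

lemma one_mem_Gset (d : ℕ) : (1 : Mat d) ∈ Gset d :=
  mem_connectedComponentIn (one_mem_Obeta d)

lemma Gset_subset_Obeta (d : ℕ) : Gset d ⊆ Obeta d := connectedComponentIn_subset _ _

lemma mul_mem_Gset_of_mem {d : ℕ} {a b c : Mat d} (ha : a ∈ Obeta d) (hb : b ∈ Gset d)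
    (hab : a * b ∈ Gset d) (hc : c ∈ Gset d) : a * c ∈ Gset d := by
  have hconn : IsPreconnected ((fun g : Mat d => a * g) '' Gset d) :=
    isPreconnected_connectedComponentIn.image _ (by fun_prop)
  have hsub : (fun g : Mat d => a * g) '' Gset d ⊆ Obeta d := by
    rintro _ ⟨g, hg, rfl⟩
    exact mul_mem_Obeta ha (Gset_subset_Obeta d hg)
  have := hconn.subset_connectedComponentIn ⟨b, hb, rfl⟩ hsub
  rw [← connectedComponentIn_eq hab] at this
  exact this ⟨c, hc, rfl⟩

lemma mul_mem_Gset {d : ℕ} {a b : Mat d} (ha : a ∈ Gset d) (hb : b ∈ Gset d) :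
    a * b ∈ Gset d :=
  mul_mem_Gset_of_mem (Gset_subset_Obeta d ha) (one_mem_Gset d) (by rwa [mul_one]) hb

lemma inv_mem_Gset {d : ℕ} {a : Mat d} (ha : a ∈ Gset d) : a⁻¹ ∈ Gset d := by
  have hO := Gset_subset_Obeta d ha
  have := mul_mem_Gset_of_mem (inv_mem_Obeta hO) ha
    (by rw [inv_mul_of_mem_Obeta hO]; exact one_mem_Gset d) (one_mem_Gset d)
  rwa [mul_one] at this

lemma mul_mem_Gh {d : ℕ} {a b : Mat d} (ha : a ∈ Gh d) (hb : b ∈ Gh d) : a * b ∈ Gh d :=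
  ⟨mul_mem_Gset ha.1 hb.1, by rw [mul_assoc, hb.2, ← mul_assoc, ha.2, mul_assoc]⟩

lemma curve_mem_Gset {d : ℕ} {c : ℝ → Mat d} (hc : Continuous c) (h0 : c 0 = 1)
    (h : ∀ t, c t ∈ Obeta d) (t : ℝ) : c t ∈ Gset d :=
  (isPreconnected_range hc).subset_connectedComponentIn ⟨0, h0⟩
    (by rintro _ ⟨s, rfl⟩; exact h s) ⟨t, rfl⟩

/-- The infinitesimal isometry `z ↦ β(b,z) a − β(a,z) b`. -/
def wedgeMat (d : ℕ) (a b : Vd d) : Mat d :=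
  Matrix.of fun i j =>
    (if (j : ℕ) ≤ 1 then (1 : ℝ) else -1) * b j * a i -
      (if (j : ℕ) ≤ 1 then (1 : ℝ) else -1) * a j * b i

lemma wedgeMat_mulVec (d : ℕ) (a b z : Vd d) :
    (wedgeMat d a b).mulVec z = betaB d b z • a - betaB d a z • b := by
  ext i
  simp only [Matrix.mulVec, dotProduct, wedgeMat, Matrix.of_apply, betaB, Pi.sub_apply,
    Pi.smul_apply, smul_eq_mul, Finset.sum_mul, ← Finset.sum_sub_distrib]
  exact Finset.sum_congr rfl fun j _ => by ring

/-- For suitable `s` and `q`, the exponential of a multiple of `wedgeMat d a b`. -/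
def planeMat (d : ℕ) (a b : Vd d) (s q : ℝ) : Mat d :=
  1 + s • wedgeMat d a b + q • (wedgeMat d a b * wedgeMat d a b)

lemma planeMat_mulVec {d : ℕ} {a b : Vd d} (hab : betaB d a b = 0) (s q : ℝ) (z : Vd d) :
    (planeMat d a b s q).mulVec z =
      z + (s * betaB d b z - q * betaB d b b * betaB d a z) • a
        - (s * betaB d a z + q * betaB d a a * betaB d b z) • b := by
  simp only [planeMat, Matrix.add_mulVec, Matrix.one_mulVec, Matrix.smul_mulVec,
    ← Matrix.mulVec_mulVec, wedgeMat_mulVec, betaB_sub_right, betaB_smul_right, hab,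
    betaB_comm d b a]
  ext i
  simp only [Pi.add_apply, Pi.sub_apply, Pi.smul_apply, smul_eq_mul]
  ring

lemma planeMat_mem_Obeta {d : ℕ} {a b : Vd d} (hab : betaB d a b = 0) {s q : ℝ}
    (h : 2 * q - betaB d a a * betaB d b b * q ^ 2 = s ^ 2) : planeMat d a b s q ∈ Obeta d := by
  refine mem_Obeta_of_isometry fun x y => ?_
  simp only [planeMat_mulVec hab, betaB_sub_right, betaB_smul_right, betaB_sub_left,
    betaB_smul_left, betaB_add_left, betaB_add_right, hab, betaB_comm d b a, betaB_comm d x a,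
    betaB_comm d x b]
  linear_combination (-betaB d b x * betaB d b y * betaB d a a
    - betaB d a x * betaB d a y * betaB d b b) * h

lemma planeMat_mem_Gset {d : ℕ} {a b : Vd d} (hab : betaB d a b = 0) {s q : ℝ → ℝ}
    (hs : Continuous s) (hq : Continuous q) (hs0 : s 0 = 0) (hq0 : q 0 = 0)
    (h : ∀ t, 2 * q t - betaB d a a * betaB d b b * q t ^ 2 = s t ^ 2) (t : ℝ) :
    planeMat d a b (s t) (q t) ∈ Gset d :=
  curve_mem_Gset (c := fun t => planeMat d a b (s t) (q t)) (by unfold planeMat; fun_prop)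
    (by simp [planeMat, hs0, hq0]) (fun t => planeMat_mem_Obeta hab (h t)) t

lemma boost_mem_Gset {d : ℕ} {a b : Vd d} (hab : betaB d a b = 0)
    (h : betaB d a a * betaB d b b = -1) (t : ℝ) :
    planeMat d a b (Real.sinh t) (Real.cosh t - 1) ∈ Gset d :=
  planeMat_mem_Gset (q := fun t => Real.cosh t - 1) hab Real.continuous_sinh
    (Real.continuous_cosh.sub continuous_const) Real.sinh_zero (by simp)
    (fun t => by rw [h]; linear_combination Real.cosh_sq t) t

lemma planeMat_zero_two_mem_Gset {d : ℕ} {a b : Vd d} (hab : betaB d a b = 0)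
    (h : betaB d a a * betaB d b b = 1) : planeMat d a b 0 2 ∈ Gset d := by
  have := planeMat_mem_Gset (q := fun t => 1 - Real.cos t) hab Real.continuous_sin
    (continuous_const.sub Real.continuous_cos) Real.sin_zero (by simp)
    (fun t => by rw [h]; linear_combination - Real.sin_sq_add_cos_sq t) Real.pi
  norm_num at this
  exact this

lemma val_evec_indices {d : ℕ} (hd : 3 ≤ d) :
    ((0 : Fin (d + 1)) : ℕ) = 0 ∧ ((1 : Fin (d + 1)) : ℕ) = 1 ∧ ((2 : Fin (d + 1)) : ℕ) = 2 ∧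
      ((3 : Fin (d + 1)) : ℕ) = 3 := by
  obtain ⟨n, rfl⟩ := Nat.exists_eq_add_of_le' hd
  refine ⟨rfl, rfl, ?_, ?_⟩ <;> exact Nat.mod_eq_of_lt (by lia)

lemma mod_evec_indices {d : ℕ} (hd : 3 ≤ d) :
    d ≠ 0 ∧ 1 % (d + 1) = 1 ∧ 2 % (d + 1) = 2 ∧ 3 % (d + 1) = 3 :=
  ⟨by lia, Nat.mod_eq_of_lt (by lia), Nat.mod_eq_of_lt (by lia), Nat.mod_eq_of_lt (by lia)⟩

lemma evec_eq_ite (d : ℕ) (i j : Fin (d + 1)) :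
    evec d i j = if (j : ℕ) = (i : ℕ) then 1 else 0 := by
  simp [evec, Fin.ext_iff]

lemma hmat_eq_wedgeMat {d : ℕ} (hd : 3 ≤ d) : hmat d = wedgeMat d (evec d 2) (evec d 1) := by
  obtain ⟨-, v1, v2, -⟩ := val_evec_indices hd
  ext i j
  simp only [hmat, wedgeMat, Matrix.of_apply, evec_eq_ite, v1, v2]
  split_ifs <;> first | lia | simp_all

lemma hmat_mulVec {d : ℕ} (hd : 3 ≤ d) (z : Vd d) :
    (hmat d).mulVec z = z 1 • evec d 2 + z 2 • evec d 1 := by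
  obtain ⟨-, v1, v2, -⟩ := val_evec_indices hd
  rw [hmat_eq_wedgeMat hd, wedgeMat_mulVec, betaB_evec_left, betaB_evec_left, v1, v2]
  norm_num

lemma mul_hmat_eq_of_mulVec {d : ℕ} {g : Mat d}
    (h : ∀ z, g.mulVec ((hmat d).mulVec z) = (hmat d).mulVec (g.mulVec z)) :
    g * hmat d = hmat d * g := by
  refine Matrix.mulVec_injective ?_
  funext z
  simp only [← Matrix.mulVec_mulVec, h]

/-- The minor of the first two coordinates of `(x, y)`. -/
def timeDet (d : ℕ) (x y : Vd d) : ℝ := x 0 * y 1 - x 1 * y 0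

lemma timeDet_ne_zero {d : ℕ} (hd : 1 ≤ d) {x y : Vd d} (hx : 0 < betaB d x x)
    (hy : 0 < betaB d y y) (hxy : betaB d x y = 0) : timeDet d x y ≠ 0 := by
  intro h
  unfold timeDet at h
  have key : ∀ p q : ℝ, p * y 0 = q * x 0 → p * y 1 = q * x 1 → p = 0 := by
    intro p q h0 h1
    have := betaB_self_nonpos hd (z := p • y - q • x)
      (by simp [h0]) (by simp [h1])
    simp only [betaB_sub_left, betaB_sub_right, betaB_smul_left, betaB_smul_right, hxy,
      betaB_comm d y x] at this
    by_contra hp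
    nlinarith [mul_pos (pow_pos (abs_pos.2 hp) 2) hy, sq_abs p, mul_nonneg (sq_nonneg q) hx.le]
  have h0 := key (x 0) (y 0) (by ring) (by linarith)
  have h1 := key (x 1) (y 1) (by linarith) (by ring)
  exact absurd hx (betaB_self_nonpos hd h0 h1).not_gt

lemma timeDet_mulVec_pos {d : ℕ} (hd : 1 ≤ d) {x y : Vd d} (hx : 0 < betaB d x x)
    (hy : 0 < betaB d y y) (hxy : betaB d x y = 0) (h : 0 < timeDet d x y)
    {g : Mat d} (hg : g ∈ Gset d) : 0 < timeDet d (g.mulVec x) (g.mulVec y) := by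
  by_contra! hle
  have hcont : Continuous fun k : Mat d => timeDet d (k.mulVec x) (k.mulVec y) := by
    unfold timeDet
    fun_prop
  obtain ⟨k, hk, hk0⟩ := isPreconnected_connectedComponentIn.intermediate_value hg
    (one_mem_Gset d) hcont.continuousOn
    (show (0 : ℝ) ∈ Set.Icc _ _ from ⟨hle, by simpa using h.le⟩)
  have hkO := Gset_subset_Obeta d hk
  exact timeDet_ne_zero hd (by rwa [hkO.2]) (by rwa [hkO.2]) (by rwa [hkO.2]) hk0

lemma coord_ineqs_of_mem_WplusDom {d : ℕ} (hd : 3 ≤ d) {x : Vd d} (hx : x ∈ WplusDom d) :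
    betaB d x x = 1 ∧ x 1 ^ 2 < x 2 ^ 2 ∧ 0 < x 0 * x 2 := by
  obtain ⟨hM, g, hg, hgx, hv0, hvv, hv1⟩ := hx
  obtain ⟨v0, v1, v2, -⟩ := val_evec_indices hd
  obtain ⟨hd0, m1, m2, m3⟩ := mod_evec_indices hd
  have hgO := Gset_subset_Obeta d hg
  have hinv : ∀ z, (g⁻¹).mulVec (g.mulVec z) = z := fun z => by
    rw [Matrix.mulVec_mulVec, inv_mul_of_mem_Obeta hgO, Matrix.one_mulVec]
  have hx1 : 0 < betaB d (evec d 0) (evec d 0) := by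
    rw [← hgx, hgO.2]; exact lt_of_lt_of_eq one_pos hM.symm
  have hdet := timeDet_mulVec_pos (by lia) hx1 hvv hv0
    (by
      rw [betaB_evec_right, v1] at hv1
      simpa [timeDet, evec_eq_ite, hd0, m1, m2, m3] using hv1) (inv_mem_Gset hg)
  rw [← hgx, hinv, hinv] at hdet
  rw [hgO.2] at hvv
  simp only [hmat_mulVec hd, timeDet, betaB_add_left, betaB_smul_left, betaB_evec_left,
    Pi.add_apply, Pi.smul_apply, smul_eq_mul, evec_eq_ite, v0, v1, v2] at hdet hvv
  norm_num at hdet hvv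
  exact ⟨hM, by linarith, hdet⟩

lemma polar_mem_WplusDom {d : ℕ} (hd : 3 ≤ d) {g : Mat d} (hg : g ∈ Gh d) {s : ℝ} (hs : 0 < s) :
    g.mulVec (Real.cosh s • evec d 0 + Real.sinh s • evec d 2) ∈ WplusDom d := by
  obtain ⟨v0, -, v2, -⟩ := val_evec_indices hd
  obtain ⟨-, m1, m2, -⟩ := mod_evec_indices hd
  have hsinh := Real.sinh_pos_iff.2 hs
  have hgO := Gset_subset_Obeta d hg.1
  have hab : betaB d (evec d 2) (evec d 0) = 0 := by
    simp [betaB_evec_left, evec_eq_ite, m2]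
  have hb := boost_mem_Gset hab (by simp [betaB_evec_left, evec_eq_ite, m2]) s
  have hbO := Gset_subset_Obeta d hb
  have hb0 : (planeMat d (evec d 2) (evec d 0) (Real.sinh s) (Real.cosh s - 1)).mulVec (evec d 0)
      = Real.cosh s • evec d 0 + Real.sinh s • evec d 2 := by
    rw [planeMat_mulVec hab]
    simp only [betaB_evec_left, evec_eq_ite, v0, v2]
    ext i
    simp
    ring
  have hb1 : (planeMat d (evec d 2) (evec d 0) (Real.sinh s) (Real.cosh s - 1)).mulVec (evec d 1)
      = evec d 1 := by
    rw [planeMat_mulVec hab]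
    simp [betaB_evec_left, evec_eq_ite, m1, m2]
  have hh : (hmat d).mulVec (g.mulVec (Real.cosh s • evec d 0 + Real.sinh s • evec d 2))
      = g.mulVec (Real.sinh s • evec d 1) := by
    rw [Matrix.mulVec_mulVec, ← hg.2, ← Matrix.mulVec_mulVec, hmat_mulVec hd]
    simp [evec_eq_ite, m1, m2]
  set b := planeMat d (evec d 2) (evec d 0) (Real.sinh s) (Real.cosh s - 1)
  have hcancel : ∀ z, (b⁻¹ * g⁻¹).mulVec (g.mulVec (b.mulVec z)) = z := fun z => by
    rw [Matrix.mulVec_mulVec, Matrix.mulVec_mulVec, mul_assoc b⁻¹, inv_mul_of_mem_Obeta hgO,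
      mul_one, inv_mul_of_mem_Obeta hbO, Matrix.one_mulVec]
  refine ⟨?_, b⁻¹ * g⁻¹, mul_mem_Gset (inv_mem_Gset hb) (inv_mem_Gset hg.1), ?_, ?_⟩
  · change betaB d _ _ = 1
    rw [hgO.2, ← hb0, hbO.2]
    simp [betaB_evec_left, evec_eq_ite]
  · rw [← hb0, hcancel]
  · rw [hh, ← hb1, ← Matrix.mulVec_smul, hcancel]
    simp [Vplus, betaB_evec_left, betaB_smul_left, betaB_smul_right, evec_eq_ite, m1, hsinh]

lemma exists_unit_spacelike {d : ℕ} (hd : 3 ≤ d) {v : Vd d} (h0 : v 0 = 0) (h1 : v 1 = 0)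
    (h2 : v 2 = 0) : ∃ (m : ℝ) (w : Vd d), v = m • w ∧ betaB d w w = -1 ∧ w 0 = 0 ∧ w 1 = 0 ∧
      w 2 = 0 := by
  obtain ⟨-, m1, m2, m3⟩ := mod_evec_indices hd
  rcases (betaB_self_nonpos (by lia) h0 h1).eq_or_lt with h | h
  · refine ⟨0, evec d 3, ?_, ?_⟩
    · rw [zero_smul, eq_zero_of_betaB_self_eq_zero (by lia) h0 h1 h]
    · simp [betaB_evec_left, evec_eq_ite, m1, m2, m3]
  · have hm : 0 < Real.sqrt (-betaB d v v) := Real.sqrt_pos.2 (by linarith)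
    have hsq := Real.sq_sqrt (show 0 ≤ -betaB d v v by linarith)
    refine ⟨Real.sqrt (-betaB d v v), (Real.sqrt (-betaB d v v))⁻¹ • v, ?_, ?_, ?_⟩
    · rw [smul_smul, mul_inv_cancel₀ hm.ne', one_smul]
    · rw [betaB_smul_left, betaB_smul_right]
      field_simp
      linarith
    · simp [h0, h1, h2]

lemma exists_sinh_cosh {a b : ℝ} (ha : 0 < a) (h : a ^ 2 - b ^ 2 = 1) :
    ∃ t, Real.cosh t = a ∧ Real.sinh t = b := by
  refine ⟨Real.arsinh b, ?_, Real.sinh_arsinh b⟩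
  rw [Real.cosh_arsinh, ← Real.sqrt_sq ha.le]
  congr 1
  linarith

lemma exists_polar_of_pos {d : ℕ} (hd : 3 ≤ d) {x : Vd d} (hM : betaB d x x = 1)
    (h12 : x 1 ^ 2 < x 2 ^ 2) (h0 : 0 < x 0) (h2 : 0 < x 2) :
    ∃ g ∈ Gh d, ∃ s : ℝ, 0 < s ∧
      x = g.mulVec (Real.cosh s • evec d 0 + Real.sinh s • evec d 2) := by
  obtain ⟨v0, v1, v2, -⟩ := val_evec_indices hd
  obtain ⟨-, m1, m2, -⟩ := mod_evec_indices hd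
  obtain ⟨m, w, hv, hww, w0, w1, w2⟩ := exists_unit_spacelike hd
    (v := x - x 0 • evec d 0 - x 1 • evec d 1 - x 2 • evec d 2)
    (by simp [evec_eq_ite, m1, m2]) (by simp [evec_eq_ite, m1, m2])
    (by simp [evec_eq_ite, m1, m2])
  have hx : x = x 0 • evec d 0 + x 1 • evec d 1 + x 2 • evec d 2 + m • w := by
    rw [← hv]; abel
  have hnorm : x 0 ^ 2 + x 1 ^ 2 - x 2 ^ 2 - m ^ 2 = 1 := by
    rw [hx] at hM
    simp only [betaB_add_left, betaB_add_right, betaB_smul_left, betaB_smul_right, betaB_evec_left,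
      betaB_evec_right, Pi.add_apply, Pi.smul_apply, smul_eq_mul, evec_eq_ite, v0, v1, v2, w0, w1,
      w2, hww] at hM
    norm_num at hM
    linarith
  have hr : 0 < Real.sqrt (x 2 ^ 2 - x 1 ^ 2) := Real.sqrt_pos.2 (by linarith)
  have hrsq := Real.sq_sqrt (show 0 ≤ x 2 ^ 2 - x 1 ^ 2 by linarith)
  set r := Real.sqrt (x 2 ^ 2 - x 1 ^ 2)
  obtain ⟨s, hs⟩ := Real.sinh_surjective r
  have hc := Real.cosh_pos s
  have hcsq := Real.cosh_sq s
  obtain ⟨t, htc, hts⟩ := exists_sinh_cosh (a := x 2 / r) (b := x 1 / r) (by positivity)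
    (by field_simp; linarith)
  obtain ⟨u, huc, hus⟩ := exists_sinh_cosh (a := x 0 / Real.cosh s) (b := m / Real.cosh s)
    (by positivity) (by field_simp; rw [hs] at hcsq; linarith)
  have hab : betaB d (evec d 2) (evec d 1) = 0 := by
    simp [betaB_evec_left, evec_eq_ite, m1, m2]
  have hwb : betaB d w (evec d 0) = 0 := by
    simp [betaB_evec_right, w0]
  have hg₁ : planeMat d (evec d 2) (evec d 1) (Real.sinh t) (Real.cosh t - 1) ∈ Gh d := by
    refine ⟨boost_mem_Gset hab (by simp [betaB_evec_left, evec_eq_ite, m1, m2]) t, ?_⟩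
    rw [planeMat, hmat_eq_wedgeMat hd]
    noncomm_ring
  have hg₂ : planeMat d w (evec d 0) (Real.sinh u) (Real.cosh u - 1) ∈ Gh d := by
    refine ⟨boost_mem_Gset hwb (by simp [betaB_evec_left, evec_eq_ite, hww]) u, ?_⟩
    refine mul_hmat_eq_of_mulVec fun z => ?_
    simp [planeMat_mulVec hwb, hmat_mulVec hd, betaB_add_right, betaB_smul_right, betaB_evec_right,
      evec_eq_ite, m1, m2, w1, w2]
  refine ⟨_, mul_mem_Gh hg₁ hg₂, s, Real.sinh_pos_iff.1 (hs ▸ hr), ?_⟩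
  rw [← Matrix.mulVec_mulVec, planeMat_mulVec hwb, planeMat_mulVec hab]
  simp only [betaB_add_right, betaB_sub_right, betaB_smul_right, betaB_evec_left,
    betaB_evec_right, evec_eq_ite, v0, v1, v2, w0, w1, w2, hww, htc, hts, huc, hus, hs]
  conv_lhs => rw [hx]
  ext i
  simp only [Pi.add_apply, Pi.sub_apply, Pi.smul_apply, smul_eq_mul]
  norm_num
  field_simp
  ring

/-- The element of `G^h` acting by `-1` on `span(e₀, e₁, e₂, e₃)`. -/
lemma exists_mem_Gh_neg {d : ℕ} (hd : 3 ≤ d) : ∃ g ∈ Gh d, ∀ z : Vd d, g.mulVec z =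
    z - (2 : ℝ) • (z 0 • evec d 0 + z 1 • evec d 1 + z 2 • evec d 2 + z 3 • evec d 3) := by
  obtain ⟨-, m1, m2, m3⟩ := mod_evec_indices hd
  have h01 : betaB d (evec d 0) (evec d 1) = 0 := by simp [betaB_evec_left, evec_eq_ite, m1]
  have h23 : betaB d (evec d 2) (evec d 3) = 0 := by simp [betaB_evec_left, evec_eq_ite, m2, m3]
  have hz : ∀ z : Vd d, (planeMat d (evec d 0) (evec d 1) 0 2 *
      planeMat d (evec d 2) (evec d 3) 0 2).mulVec z =
      z - (2 : ℝ) • (z 0 • evec d 0 + z 1 • evec d 1 + z 2 • evec d 2 + z 3 • evec d 3) := by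
    intro z
    rw [← Matrix.mulVec_mulVec, planeMat_mulVec h01, planeMat_mulVec h23]
    ext i
    simp [betaB_evec_left, evec_eq_ite, m1, m2, m3]
    ring
  refine ⟨_, ⟨mul_mem_Gset (planeMat_zero_two_mem_Gset h01 ?_) (planeMat_zero_two_mem_Gset h23 ?_),
    mul_hmat_eq_of_mulVec fun z => ?_⟩, hz⟩
  · simp [betaB_evec_left, evec_eq_ite, m1]
  · simp [betaB_evec_left, evec_eq_ite, m2, m3]
  · rw [hz, hz, hmat_mulVec hd, hmat_mulVec hd]
    ext i
    simp [evec_eq_ite, m1, m2, m3]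
    split_ifs <;> ring

/-- For `d ≥ 3`, the positivity domain coincides with the polar wedge domain:
`W_M⁺(h) = {g·(cosh(s)e₀ + sinh(s)e₂) : g ∈ G^h, s > 0}`. -/
theorem stmt14 (d : ℕ) (hd : 3 ≤ d) :
    WplusDom d = {y : Vd d | ∃ g ∈ Gh d, ∃ s : ℝ, 0 < s ∧
      y = g.mulVec (Real.cosh s • evec d 0 + Real.sinh s • evec d 2)} := by
  refine Set.Subset.antisymm (fun x hx => ?_) ?_
  · obtain ⟨hM, h12, h02⟩ := coord_ineqs_of_mem_WplusDom hd hx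
    rcases pos_and_pos_or_neg_and_neg_of_mul_pos h02 with ⟨h0, h2⟩ | ⟨h0, h2⟩
    · exact exists_polar_of_pos hd hM h12 h0 h2
    obtain ⟨-, m1, m2, m3⟩ := mod_evec_indices hd
    obtain ⟨k, hk, hkz⟩ := exists_mem_Gh_neg hd
    have hkk : k.mulVec (k.mulVec x) = x := by
      rw [hkz, hkz]
      ext i
      simp [evec_eq_ite, m1, m2, m3]
      split_ifs <;> ring
    have hk0 : k.mulVec x 0 = -x 0 := by
      simp [hkz, evec_eq_ite, m1, m2, m3]; ring
    have hk1 : k.mulVec x 1 = -x 1 := by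
      simp [hkz, evec_eq_ite, m1, m2, m3]; ring
    have hk2 : k.mulVec x 2 = -x 2 := by
      simp [hkz, evec_eq_ite, m1, m2, m3]; ring
    obtain ⟨g, hg, s, hs, hgs⟩ := exists_polar_of_pos hd (x := k.mulVec x)
      (by rw [(Gset_subset_Obeta d hk.1).2, hM]) (by rw [hk1, hk2]; simpa using h12)
      (by rw [hk0]; linarith) (by rw [hk2]; linarith)
    exact ⟨k * g, mul_mem_Gh hk hg, s, hs, by rw [← Matrix.mulVec_mulVec, ← hgs, hkk]⟩
  · rintro _ ⟨g, hg, s, hs, rfl⟩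
    exact polar_mem_WplusDom hd hg hs
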